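/- Let 𝓕 be any class of stopping rules such that (i) every ψ ∈ 𝓕 satisfies R_N(ψ) → R(ψ) as N → ∞, and (ii) 𝓕 contains all truncated stopping rules (⋃_{N≥1} 𝓕ᴺ ⊆ 𝓕). Then Q₀ = inf_{ψ ∈ 𝓕} R(ψ), where Q₀ = lim_{N→∞} Q₀ᴺ. -/

import Mathlib

open MeasureTheory ENNReal Filter ProbabilityTheory

namespace SDP

variable {Θ X D : Type*} [MeasurableSpace Θ] [MeasurableSpace X] [MeasurableSpace D]

/-- The product measure `μⁿ` on `Xⁿ`. -/
noncomputable def pm (μ : Measure X) (n : ℕ) : Measure (Fin n → X) :=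
  Measure.pi fun _ => μ

/-- `t_n^ψ = (1-ψ₁)⋯(1-ψ_{n-1})`, with `t₁^ψ ≡ 1`. -/
noncomputable def t (ψ : ∀ n, (Fin n → X) → ℝ≥0∞) : ∀ n, (Fin n → X) → ℝ≥0∞
  | 0, _ => 1
  | 1, _ => 1
  | n + 2, x => t ψ (n + 1) (Fin.init x) * (1 - ψ (n + 1) (Fin.init x))

/-- `s_n^ψ = (1-ψ₁)⋯(1-ψ_{n-1})ψ_n`. -/
noncomputable def s (ψ : ∀ n, (Fin n → X) → ℝ≥0∞) (n : ℕ) (x : Fin n → X) : ℝ≥0∞ :=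
  t ψ n x * ψ n x

/-- A stopping rule: a sequence of measurable functions with values in `[0,1]`. -/
def IsStoppingRule (ψ : ∀ n, (Fin n → X) → ℝ≥0∞) : Prop :=
  (∀ n, Measurable (ψ n)) ∧ ∀ n x, ψ n x ≤ 1

/-- A decision rule: a sequence of measurable functions with values in `D`. -/
def IsDecisionRule (δ : ∀ n, (Fin n → X) → D) : Prop := ∀ n, Measurable (δ n)

/-- `ψ` is truncated at `N`: `ψ_n ≡ 1` for all `n ≥ N`. -/
def TruncatedAt (ψ : ∀ n, (Fin n → X) → ℝ≥0∞) (N : ℕ) : Prop :=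
  ∀ n, N ≤ n → ∀ x, ψ n x = 1

/-- A consistent family of joint probability densities `f_θⁿ` w.r.t. `μⁿ`. -/
def IsDensityFamily (μ : Measure X) (f : Θ → ∀ n, (Fin n → X) → ℝ≥0∞) : Prop :=
  (∀ n, Measurable fun p : Θ × (Fin n → X) => f p.1 n p.2) ∧
  (∀ θ x, f θ 0 x = 1) ∧
  (∀ θ n, ∫⁻ x, f θ n x ∂pm μ n = 1) ∧
  ∀ θ n (x : Fin n → X), ∫⁻ y, f θ (n + 1) (Fin.snoc x y) ∂μ = f θ n x

/-- The average loss `W(ψ,δ)`. -/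
noncomputable def W (π₁ : Measure Θ) (μ : Measure X) (w : Θ → D → ℝ≥0∞)
    (f : Θ → ∀ n, (Fin n → X) → ℝ≥0∞) (ψ : ∀ n, (Fin n → X) → ℝ≥0∞)
    (δ : ∀ n, (Fin n → X) → D) : ℝ≥0∞ :=
  ∑' n : ℕ, ∫⁻ θ, ∫⁻ x, s ψ (n + 1) x * w θ (δ (n + 1) x) * f θ (n + 1) x ∂pm μ (n + 1) ∂π₁

/-- The partial average loss `W_i(ψ,δ)` (integration over `Θᵢ`). -/
noncomputable def Wi (π₁ : Measure Θ) (μ : Measure X) (w : Θ → D → ℝ≥0∞)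
    (f : Θ → ∀ n, (Fin n → X) → ℝ≥0∞) (Θi : Set Θ) (ψ : ∀ n, (Fin n → X) → ℝ≥0∞)
    (δ : ∀ n, (Fin n → X) → D) : ℝ≥0∞ :=
  ∑' n : ℕ,
    ∫⁻ θ in Θi, ∫⁻ x, s ψ (n + 1) x * w θ (δ (n + 1) x) * f θ (n + 1) x ∂pm μ (n + 1) ∂π₁

/-- `P^{π}(τ_ψ = n)`. -/
noncomputable def PtauEq (π₂ : Measure Θ) (μ : Measure X)
    (f : Θ → ∀ n, (Fin n → X) → ℝ≥0∞) (ψ : ∀ n, (Fin n → X) → ℝ≥0∞) (n : ℕ) : ℝ≥0∞ :=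
  ∫⁻ θ, ∫⁻ x, s ψ n x * f θ n x ∂pm μ n ∂π₂

/-- `P^{π}(τ_ψ < ∞)`. -/
noncomputable def Pfin (π₂ : Measure Θ) (μ : Measure X)
    (f : Θ → ∀ n, (Fin n → X) → ℝ≥0∞) (ψ : ∀ n, (Fin n → X) → ℝ≥0∞) : ℝ≥0∞ :=
  ∑' n : ℕ, PtauEq π₂ μ f ψ (n + 1)

/-- The average sample number `N(ψ)` (equal to `∞` if `P^{π₂}(τ_ψ < ∞) < 1`). -/
noncomputable def ASN (π₂ : Measure Θ) (μ : Measure X)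
    (f : Θ → ∀ n, (Fin n → X) → ℝ≥0∞) (ψ : ∀ n, (Fin n → X) → ℝ≥0∞) : ℝ≥0∞ :=
  if Pfin π₂ μ f ψ = 1 then ∑' n : ℕ, ((n : ℝ≥0∞) + 1) * PtauEq π₂ μ f ψ (n + 1) else ⊤

/-- `fⁿ = ∫_Θ f_θⁿ dπ₂(θ)` (in particular `f⁰ ≡ 1`). -/
noncomputable def fbar (π₂ : Measure Θ) (f : Θ → ∀ n, (Fin n → X) → ℝ≥0∞)
    (n : ℕ) (x : Fin n → X) : ℝ≥0∞ :=
  ∫⁻ θ, f θ n x ∂π₂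

/-- `R(ψ) = Σₙ ∫ sₙ^ψ (c n fⁿ + lₙ) dμⁿ` if `P^{π₂}(τ_ψ<∞) = 1`, `∞` otherwise. -/
noncomputable def R (π₂ : Measure Θ) (μ : Measure X) (c : ℝ≥0∞)
    (f : Θ → ∀ n, (Fin n → X) → ℝ≥0∞) (l : ∀ n, (Fin n → X) → ℝ≥0∞)
    (ψ : ∀ n, (Fin n → X) → ℝ≥0∞) : ℝ≥0∞ :=
  if Pfin π₂ μ f ψ = 1 then
    ∑' n : ℕ, ∫⁻ x, s ψ (n + 1) x *
      (c * ((n : ℝ≥0∞) + 1) * fbar π₂ f (n + 1) x + l (n + 1) x) ∂pm μ (n + 1)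
  else ⊤

/-- `R_N(ψ)`, the risk of `ψ` truncated at `N`. -/
noncomputable def RN (π₂ : Measure Θ) (μ : Measure X) (c : ℝ≥0∞)
    (f : Θ → ∀ n, (Fin n → X) → ℝ≥0∞) (l : ∀ n, (Fin n → X) → ℝ≥0∞)
    (N : ℕ) (ψ : ∀ n, (Fin n → X) → ℝ≥0∞) : ℝ≥0∞ :=
  (∑ n ∈ Finset.range (N - 1), ∫⁻ x, s ψ (n + 1) x *
      (c * ((n : ℝ≥0∞) + 1) * fbar π₂ f (n + 1) x + l (n + 1) x) ∂pm μ (n + 1)) +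
  ∫⁻ x, t ψ N x * (c * (N : ℝ≥0∞) * fbar π₂ f N x + l N x) ∂pm μ N

/-- `Vₙᴺ`, defined backwards from `V_Nᴺ = l_N` by `Vₙᴺ = min{lₙ, Qₙᴺ}`. -/
noncomputable def V (μ : Measure X) (c : ℝ≥0∞) (fb l : ∀ n, (Fin n → X) → ℝ≥0∞)
    (N n : ℕ) (x : Fin n → X) : ℝ≥0∞ :=
  if h : n < N then
    min (l n x) (c * fb n x + ∫⁻ y, V μ c fb l N (n + 1) (Fin.snoc x y) ∂μ)
  else l n x
termination_by N - n
decreasing_by omega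

/-- `Qₙᴺ = c fⁿ + ∫ Vₙ₊₁ᴺ(⋅,y) dμ(y)`. -/
noncomputable def Q (μ : Measure X) (c : ℝ≥0∞) (fb l : ∀ n, (Fin n → X) → ℝ≥0∞)
    (N n : ℕ) (x : Fin n → X) : ℝ≥0∞ :=
  c * fb n x + ∫⁻ y, V μ c fb l N (n + 1) (Fin.snoc x y) ∂μ

/-- `Vₙ = lim_{N→∞} Vₙᴺ` (the sequence is nonincreasing in `N`, so the limit is the inf). -/
noncomputable def Vlim (μ : Measure X) (c : ℝ≥0∞) (fb l : ∀ n, (Fin n → X) → ℝ≥0∞)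
    (n : ℕ) (x : Fin n → X) : ℝ≥0∞ :=
  ⨅ N, V μ c fb l N n x

/-- `Qₙ = lim_{N→∞} Qₙᴺ = c fⁿ + ∫ Vₙ₊₁(⋅,y) dμ(y)`. -/
noncomputable def Qlim (μ : Measure X) (c : ℝ≥0∞) (fb l : ∀ n, (Fin n → X) → ℝ≥0∞)
    (n : ℕ) (x : Fin n → X) : ℝ≥0∞ :=
  c * fb n x + ∫⁻ y, Vlim μ c fb l (n + 1) (Fin.snoc x y) ∂μ

end SDP

namespace SDP

section

variable {Θ X D : Type*} [MeasurableSpace Θ] [MeasurableSpace X] [MeasurableSpace D]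

theorem measurable_snoc {n : ℕ} :
    Measurable fun p : (Fin n → X) × X => (Fin.snoc p.1 p.2 : Fin (n + 1) → X) := by
  refine measurable_pi_lambda _ fun i => ?_
  induction i using Fin.lastCases with
  | last => simpa using measurable_snd
  | cast i => simpa [Function.comp_def] using (measurable_pi_apply i).comp measurable_fst

theorem measurable_init {n : ℕ} :
    Measurable fun x : Fin (n + 1) → X => (Fin.init x : Fin n → X) :=
  measurable_pi_lambda _ fun _ => measurable_pi_apply _

instance sigmaFinite_pm (μ : Measure X) [SigmaFinite μ] (n : ℕ) : SigmaFinite (pm μ n) := by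
  unfold pm; infer_instance

theorem lintegral_pm_zero (μ : Measure X) (g : (Fin 0 → X) → ℝ≥0∞) :
    ∫⁻ x, g x ∂pm μ 0 = g ![] := by
  rw [pm, Measure.pi_of_empty _ ![], lintegral_dirac]

theorem lintegral_pm_succ (μ : Measure X) [SigmaFinite μ] {n : ℕ}
    {g : (Fin (n + 1) → X) → ℝ≥0∞} (hg : Measurable g) :
    ∫⁻ z, g z ∂pm μ (n + 1) = ∫⁻ x, ∫⁻ y, g (Fin.snoc x y) ∂μ ∂pm μ n := by
  have h := (measurePreserving_piFinSuccAbove (fun _ : Fin (n + 1) => μ) (Fin.last n)).symm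
  rw [pm, ← h.lintegral_comp hg]
  have hm : Measurable fun p : X × (Fin n → X) =>
      g ((MeasurableEquiv.piFinSuccAbove (fun _ : Fin (n + 1) => X) (Fin.last n)).symm p) :=
    hg.comp (MeasurableEquiv.measurable _)
  rw [lintegral_prod_symm' _ hm]
  exact lintegral_congr fun x => lintegral_congr fun y =>
    congrArg g (Fin.insertNth_last' y x)

theorem measurable_lintegral_snoc (μ : Measure X) [SigmaFinite μ] {n : ℕ}
    {g : (Fin (n + 1) → X) → ℝ≥0∞} (hg : Measurable g) :
    Measurable fun x : Fin n → X => ∫⁻ y, g (Fin.snoc x y) ∂μ :=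
  (hg.comp measurable_snoc).lintegral_prod_right'

theorem measurable_t {ψ : ∀ n, (Fin n → X) → ℝ≥0∞} (hψ : ∀ n, Measurable (ψ n)) :
    ∀ n, Measurable (t ψ n)
  | 0 => by simpa only [funext (t.eq_1 ψ)] using measurable_const
  | 1 => by simpa only [funext (t.eq_2 ψ)] using measurable_const
  | n + 2 => by
    simp only [funext (t.eq_3 ψ n)]
    exact ((measurable_t hψ (n + 1)).comp measurable_init).mul
      (measurable_const.sub ((hψ (n + 1)).comp measurable_init))

theorem V_of_lt (μ : Measure X) (c : ℝ≥0∞) (fb l : ∀ n, (Fin n → X) → ℝ≥0∞) {N n : ℕ}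
    (h : n < N) (x : Fin n → X) : V μ c fb l N n x = min (l n x) (Q μ c fb l N n x) := by
  rw [V, dif_pos h, Q]

theorem V_of_le (μ : Measure X) (c : ℝ≥0∞) (fb l : ∀ n, (Fin n → X) → ℝ≥0∞) {N n : ℕ}
    (h : N ≤ n) (x : Fin n → X) : V μ c fb l N n x = l n x := by
  rw [V, dif_neg h.not_gt]

theorem measurable_V (μ : Measure X) [SigmaFinite μ] (c : ℝ≥0∞)
    {fb l : ∀ n, (Fin n → X) → ℝ≥0∞} (hfb : ∀ n, Measurable (fb n))
    (hl : ∀ n, Measurable (l n)) (N n : ℕ) : Measurable (V μ c fb l N n) := by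
  by_cases h : n < N
  · simp only [funext (V_of_lt μ c fb l h), Q]
    have := measurable_V μ c hfb hl N (n + 1)
    exact (hl n).min (((hfb n).const_mul c).add (measurable_lintegral_snoc μ this))
  · rw [funext (V_of_le μ c fb l (not_lt.mp h))]
    exact hl n
termination_by N - n

theorem measurable_Q (μ : Measure X) [SigmaFinite μ] (c : ℝ≥0∞)
    {fb l : ∀ n, (Fin n → X) → ℝ≥0∞} (hfb : ∀ n, Measurable (fb n))
    (hl : ∀ n, Measurable (l n)) (N n : ℕ) : Measurable (Q μ c fb l N n) :=
  ((hfb n).const_mul c).add (measurable_lintegral_snoc μ (measurable_V μ c hfb hl N (n + 1)))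

theorem V_succ_le (μ : Measure X) (c : ℝ≥0∞) (fb l : ∀ n, (Fin n → X) → ℝ≥0∞) (N n : ℕ)
    (x : Fin n → X) : V μ c fb l (N + 1) n x ≤ V μ c fb l N n x := by
  by_cases h : n < N
  · rw [V_of_lt μ c fb l h, V_of_lt μ c fb l (h.trans N.lt_succ_self), Q, Q]
    have := V_succ_le μ c fb l N (n + 1)
    gcongr
    exact this _
  · rw [V_of_le μ c fb l (not_lt.mp h)]
    by_cases h' : n < N + 1
    · exact (V_of_lt μ c fb l h' x).trans_le (min_le_left _ _)
    · exact (V_of_le μ c fb l (not_lt.mp h') x).le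
termination_by N - n

theorem antitone_V (μ : Measure X) (c : ℝ≥0∞) (fb l : ∀ n, (Fin n → X) → ℝ≥0∞) (n : ℕ) :
    Antitone fun N => V μ c fb l N n :=
  antitone_nat_of_succ_le fun N x => V_succ_le μ c fb l N n x

theorem Q_zero_eq (μ : Measure X) [SigmaFinite μ] (c : ℝ≥0∞)
    {fb l : ∀ n, (Fin n → X) → ℝ≥0∞} (hfb : ∀ n, Measurable (fb n))
    (hl : ∀ n, Measurable (l n)) (N : ℕ) :
    Q μ c fb l N 0 ![] = c * fb 0 ![] + ∫⁻ x, V μ c fb l N 1 x ∂pm μ 1 := by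
  rw [Q, lintegral_pm_succ μ (measurable_V μ c hfb hl N 1), lintegral_pm_zero]

theorem Qlim_zero_eq_iInf (μ : Measure X) [SigmaFinite μ] (c : ℝ≥0∞)
    {fb l : ∀ n, (Fin n → X) → ℝ≥0∞} (hfb : ∀ n, Measurable (fb n))
    (hl : ∀ n, Measurable (l n)) (hl1 : ∫⁻ x, l 1 x ∂pm μ 1 ≠ ⊤) :
    Qlim μ c fb l 0 ![] = ⨅ N, Q μ c fb l N 0 ![] := by
  have hV : Measurable (Vlim μ c fb l 1) :=
    Measurable.iInf fun N => measurable_V μ c hfb hl N 1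
  have h1 : ∫⁻ y, Vlim μ c fb l 1 (Fin.snoc (![] : Fin 0 → X) y) ∂μ
      = ∫⁻ x, Vlim μ c fb l 1 x ∂pm μ 1 := by
    rw [lintegral_pm_succ μ hV, lintegral_pm_zero]
  have h2 : ∫⁻ x, Vlim μ c fb l 1 x ∂pm μ 1 = ⨅ N, ∫⁻ x, V μ c fb l N 1 x ∂pm μ 1 := by
    refine lintegral_iInf (fun N => measurable_V μ c hfb hl N 1) (antitone_V μ c fb l 1) ?_
    rwa [funext (V_of_le μ c fb l zero_le_one)]
  simp only [Q_zero_eq μ c hfb hl]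
  rw [← ENNReal.add_iInf, ← h2, ← h1, Qlim]

/-- The risk of a stopping rule that is followed up to stage `k` and then incurs the terminal
cost `v`. -/
noncomputable def stageRisk (μ : Measure X) (c : ℝ≥0∞) (fb l : ∀ n, (Fin n → X) → ℝ≥0∞)
    (ψ : ∀ n, (Fin n → X) → ℝ≥0∞) (k : ℕ) (v : (Fin k → X) → ℝ≥0∞) : ℝ≥0∞ :=
  (∑ n ∈ Finset.range (k - 1), ∫⁻ x, s ψ (n + 1) x *
      (c * ((n : ℝ≥0∞) + 1) * fb (n + 1) x + l (n + 1) x) ∂pm μ (n + 1)) +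
  ∫⁻ x, t ψ k x * (c * (k : ℝ≥0∞) * fb k x + v x) ∂pm μ k

theorem stageRisk_succ (μ : Measure X) [SigmaFinite μ] (c : ℝ≥0∞)
    {fb l : ∀ n, (Fin n → X) → ℝ≥0∞} (hfb : ∀ n, Measurable (fb n))
    (hl : ∀ n, Measurable (l n))
    (hcons : ∀ n (x : Fin n → X), ∫⁻ y, fb (n + 1) (Fin.snoc x y) ∂μ = fb n x)
    {ψ : ∀ n, (Fin n → X) → ℝ≥0∞} (hψ : IsStoppingRule ψ) (k : ℕ)
    {v : (Fin (k + 2) → X) → ℝ≥0∞} (hv : Measurable v) :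
    stageRisk μ c fb l ψ (k + 2) v = stageRisk μ c fb l ψ (k + 1) fun x =>
      ψ (k + 1) x * l (k + 1) x +
        (1 - ψ (k + 1) x) * (c * fb (k + 1) x + ∫⁻ y, v (Fin.snoc x y) ∂μ) := by
  have ht := measurable_t hψ.1
  have hs : Measurable (s ψ (k + 1)) := (ht _).mul (hψ.1 _)
  have htv : Measurable fun x =>
      t ψ (k + 2) x * (c * ((k + 2 : ℕ) : ℝ≥0∞) * fb (k + 2) x + v x) :=
    (ht _).mul (((hfb _).const_mul _).add hv)
  have hsl : Measurable fun x =>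
      s ψ (k + 1) x * (c * ((k : ℝ≥0∞) + 1) * fb (k + 1) x + l (k + 1) x) :=
    hs.mul (((hfb _).const_mul _).add (hl _))
  simp only [stageRisk, Nat.add_sub_cancel, show k + 2 - 1 = k + 1 from rfl,
    Finset.sum_range_succ, add_assoc]
  congr 1
  rw [lintegral_pm_succ μ htv, ← lintegral_add_left hsl]
  refine lintegral_congr fun x => ?_
  have hsnoc : Measurable fun y : X => (Fin.snoc x y : Fin (k + 2) → X) :=
    measurable_snoc.comp measurable_prodMk_left
  have hint : ∫⁻ y, t ψ (k + 2) (Fin.snoc x y) *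
      (c * ((k + 2 : ℕ) : ℝ≥0∞) * fb (k + 2) (Fin.snoc x y) + v (Fin.snoc x y)) ∂μ
      = t ψ (k + 1) x * (1 - ψ (k + 1) x) *
        (c * ((k + 2 : ℕ) : ℝ≥0∞) * fb (k + 1) x + ∫⁻ y, v (Fin.snoc x y) ∂μ) := by
    simp only [t, Fin.init_snoc]
    have hfx : Measurable fun y => fb (k + 2) (Fin.snoc x y) := (hfb _).comp hsnoc
    have hvx : Measurable fun y => v (Fin.snoc x y) := hv.comp hsnoc
    rw [lintegral_const_mul _ (by fun_prop), lintegral_add_left (by fun_prop),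
      lintegral_const_mul _ hfx, hcons]
  have hone : ψ (k + 1) x + (1 - ψ (k + 1) x) = 1 := add_tsub_cancel_of_le (hψ.2 _ _)
  rw [hint, s]
  push_cast
  generalize 1 - ψ (k + 1) x = b at *
  generalize ψ (k + 1) x = a at *
  calc _ = t ψ (k + 1) x * ((a + b) * (c * (k + 1) * fb (k + 1) x) + (a * l (k + 1) x +
        b * (c * fb (k + 1) x + ∫⁻ y, v (Fin.snoc x y) ∂μ))) := by ring
    _ = _ := by rw [hone, one_mul]

theorem stageRisk_mono (μ : Measure X) (c : ℝ≥0∞) (fb l : ∀ n, (Fin n → X) → ℝ≥0∞)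
    (ψ : ∀ n, (Fin n → X) → ℝ≥0∞) {k : ℕ} {u v : (Fin k → X) → ℝ≥0∞} (h : ∀ x, u x ≤ v x) :
    stageRisk μ c fb l ψ k u ≤ stageRisk μ c fb l ψ k v := by
  unfold stageRisk
  gcongr
  exact h _

theorem stageRisk_one (μ : Measure X) [SigmaFinite μ] (c : ℝ≥0∞)
    {fb l : ∀ n, (Fin n → X) → ℝ≥0∞} (hfb : ∀ n, Measurable (fb n))
    (hl : ∀ n, Measurable (l n))
    (hcons : ∀ n (x : Fin n → X), ∫⁻ y, fb (n + 1) (Fin.snoc x y) ∂μ = fb n x)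
    (ψ : ∀ n, (Fin n → X) → ℝ≥0∞) (N : ℕ) :
    stageRisk μ c fb l ψ 1 (V μ c fb l N 1) = Q μ c fb l N 0 ![] := by
  simp only [stageRisk, Nat.sub_self, Finset.range_zero, Finset.sum_empty, zero_add, t, one_mul,
    Nat.cast_one, mul_one]
  rw [lintegral_add_left ((hfb 1).const_mul c), lintegral_const_mul _ (hfb 1),
    lintegral_pm_succ μ (hfb 1), lintegral_pm_zero, hcons, Q_zero_eq μ c hfb hl]

theorem Q_zero_le_stageRisk (μ : Measure X) [SigmaFinite μ] (c : ℝ≥0∞)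
    {fb l : ∀ n, (Fin n → X) → ℝ≥0∞} (hfb : ∀ n, Measurable (fb n))
    (hl : ∀ n, Measurable (l n))
    (hcons : ∀ n (x : Fin n → X), ∫⁻ y, fb (n + 1) (Fin.snoc x y) ∂μ = fb n x)
    {ψ : ∀ n, (Fin n → X) → ℝ≥0∞} (hψ : IsStoppingRule ψ) {N k : ℕ} (hk : k < N) :
    Q μ c fb l N 0 ![] ≤ stageRisk μ c fb l ψ (k + 1) (V μ c fb l N (k + 1)) := by
  induction k with
  | zero => exact (stageRisk_one μ c hfb hl hcons ψ N).ge
  | succ k ih =>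
    refine (ih (by omega)).trans ?_
    rw [stageRisk_succ μ c hfb hl hcons hψ k (measurable_V μ c hfb hl N _)]
    refine stageRisk_mono μ c fb l ψ fun x => ?_
    have hone : ψ (k + 1) x + (1 - ψ (k + 1) x) = 1 := add_tsub_cancel_of_le (hψ.2 _ _)
    rw [V_of_lt μ c fb l hk]
    calc _ = (ψ (k + 1) x + (1 - ψ (k + 1) x)) *
          min (l (k + 1) x) (Q μ c fb l N (k + 1) x) := by rw [hone, one_mul]
      _ ≤ _ := by
        rw [add_mul]
        gcongr
        · exact min_le_left _ _
        · exact min_le_right _ _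

open Classical in
/-- The optimal stopping rule among those truncated at `N`. -/
noncomputable def optimalRule (μ : Measure X) (c : ℝ≥0∞) (fb l : ∀ n, (Fin n → X) → ℝ≥0∞)
    (N n : ℕ) (x : Fin n → X) : ℝ≥0∞ :=
  if N ≤ n ∨ l n x ≤ Q μ c fb l N n x then 1 else 0

theorem truncatedAt_optimalRule (μ : Measure X) (c : ℝ≥0∞)
    (fb l : ∀ n, (Fin n → X) → ℝ≥0∞) (N : ℕ) : TruncatedAt (optimalRule μ c fb l N) N :=
  fun _ hn _ => if_pos (Or.inl hn)

theorem isStoppingRule_optimalRule (μ : Measure X) [SigmaFinite μ] (c : ℝ≥0∞)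
    {fb l : ∀ n, (Fin n → X) → ℝ≥0∞} (hfb : ∀ n, Measurable (fb n))
    (hl : ∀ n, Measurable (l n)) (N : ℕ) : IsStoppingRule (optimalRule μ c fb l N) := by
  refine ⟨fun n => ?_, fun n x => ?_⟩
  · exact Measurable.ite ((MeasurableSet.const _).union
      (measurableSet_le (hl n) (measurable_Q μ c hfb hl N n))) measurable_const measurable_const
  · unfold optimalRule
    split_ifs <;> simp

theorem stageRisk_optimalRule (μ : Measure X) [SigmaFinite μ] (c : ℝ≥0∞)
    {fb l : ∀ n, (Fin n → X) → ℝ≥0∞} (hfb : ∀ n, Measurable (fb n))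
    (hl : ∀ n, Measurable (l n))
    (hcons : ∀ n (x : Fin n → X), ∫⁻ y, fb (n + 1) (Fin.snoc x y) ∂μ = fb n x)
    {N k : ℕ} (hk : k < N) :
    stageRisk μ c fb l (optimalRule μ c fb l N) (k + 1) (V μ c fb l N (k + 1))
      = Q μ c fb l N 0 ![] := by
  induction k with
  | zero => exact stageRisk_one μ c hfb hl hcons _ N
  | succ k ih =>
    rw [← ih (by omega), stageRisk_succ μ c hfb hl hcons
      (isStoppingRule_optimalRule μ c hfb hl N) k (measurable_V μ c hfb hl N _)]
    congr 1
    funext x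
    rw [V_of_lt μ c fb l hk, optimalRule]
    by_cases h : l (k + 1) x ≤ Q μ c fb l N (k + 1) x
    · simp [h]
    · rw [if_neg (not_or.mpr ⟨by omega, h⟩), min_eq_right (not_le.mp h).le]
      simp [Q]

theorem RN_eq_stageRisk (π₂ : Measure Θ) (μ : Measure X) (c : ℝ≥0∞)
    (f : Θ → ∀ n, (Fin n → X) → ℝ≥0∞) (l ψ : ∀ n, (Fin n → X) → ℝ≥0∞) (N : ℕ) :
    RN π₂ μ c f l N ψ = stageRisk μ c (fbar π₂ f) l ψ N (V μ c (fbar π₂ f) l N N) := by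
  rw [funext (V_of_le μ c (fbar π₂ f) l le_rfl)]
  rfl

theorem RN_succ_of_truncatedAt (π₂ : Measure Θ) (μ : Measure X) (c : ℝ≥0∞)
    (f : Θ → ∀ n, (Fin n → X) → ℝ≥0∞) (l : ∀ n, (Fin n → X) → ℝ≥0∞)
    {ψ : ∀ n, (Fin n → X) → ℝ≥0∞} {N : ℕ} (hψ : TruncatedAt ψ (N + 1)) {M : ℕ} (hM : N ≤ M) :
    RN π₂ μ c f l (M + 2) ψ = RN π₂ μ c f l (M + 1) ψ := by
  have h := hψ (M + 1) (by omega)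
  simp [RN, Finset.sum_range_succ, s, t, h]

theorem R_eq_RN_of_truncatedAt (π₂ : Measure Θ) (μ : Measure X) (c : ℝ≥0∞)
    (f : Θ → ∀ n, (Fin n → X) → ℝ≥0∞) (l : ∀ n, (Fin n → X) → ℝ≥0∞)
    {ψ : ∀ n, (Fin n → X) → ℝ≥0∞} {N : ℕ} (hψ : TruncatedAt ψ (N + 1))
    (hlim : Tendsto (fun N => RN π₂ μ c f l N ψ) atTop (nhds (R π₂ μ c f l ψ))) :
    R π₂ μ c f l ψ = RN π₂ μ c f l (N + 1) ψ := by
  refine tendsto_nhds_unique hlim (tendsto_atTop_of_eventually_const (i₀ := N + 1) fun M hM => ?_)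
  induction M, hM using Nat.le_induction with
  | base => rfl
  | succ M hM ih =>
    obtain ⟨M, rfl⟩ := Nat.exists_eq_add_of_le' (Nat.one_le_of_lt hM)
    rw [RN_succ_of_truncatedAt π₂ μ c f l hψ (by omega), ih]

theorem measurable_fbar (π₂ : Measure Θ) [SFinite π₂] {μ : Measure X}
    {f : Θ → ∀ n, (Fin n → X) → ℝ≥0∞} (hf : IsDensityFamily μ f) (n : ℕ) :
    Measurable (fbar π₂ f n) :=
  (hf.1 n).lintegral_prod_left'

theorem lintegral_fbar_snoc (π₂ : Measure Θ) [SFinite π₂] (μ : Measure X) [SFinite μ]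
    {f : Θ → ∀ n, (Fin n → X) → ℝ≥0∞} (hf : IsDensityFamily μ f) (n : ℕ) (x : Fin n → X) :
    ∫⁻ y, fbar π₂ f (n + 1) (Fin.snoc x y) ∂μ = fbar π₂ f n x := by
  have hm : Measurable fun p : X × Θ => f p.2 (n + 1) (Fin.snoc x p.1) :=
    (hf.1 (n + 1)).comp (measurable_snd.prodMk
      (measurable_snoc.comp (measurable_const.prodMk measurable_fst)))
  simp only [fbar]
  rw [lintegral_lintegral_swap hm.aemeasurable]
  exact lintegral_congr fun θ => hf.2.2.2 θ n x

theorem measurable_bayesLoss (π₁ : Measure Θ) [SFinite π₁] {μ : Measure X}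
    {f : Θ → ∀ n, (Fin n → X) → ℝ≥0∞} (hf : IsDensityFamily μ f) {w : Θ → D → ℝ≥0∞}
    (hw : Measurable (Function.uncurry w)) {δ : ∀ n, (Fin n → X) → D} (hδ : IsDecisionRule δ)
    (n : ℕ) : Measurable fun x => ∫⁻ θ, w θ (δ n x) * f θ n x ∂π₁ := by
  have hm : Measurable fun p : Θ × (Fin n → X) => w p.1 (δ n p.2) * f p.1 n p.2 :=
    (hw.comp (measurable_fst.prodMk ((hδ n).comp measurable_snd))).mul (hf.1 n)
  exact hm.lintegral_prod_left'

end

end SDP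

open SDP MeasureTheory ENNReal Filter in
/-- if `𝓕` is a class of stopping rules with `R_N(ψ) → R(ψ)` for all `ψ ∈ 𝓕`,
containing all truncated stopping rules, then `Q₀ = inf_{ψ ∈ 𝓕} R(ψ)`. -/
theorem statement_7
    {Θ X D : Type*} [MeasurableSpace Θ] [MeasurableSpace X] [MeasurableSpace D]
    (μ : Measure X) [SigmaFinite μ]
    (π₁ π₂ : Measure Θ) [IsProbabilityMeasure π₁] [IsProbabilityMeasure π₂]
    (f : Θ → ∀ n, (Fin n → X) → ℝ≥0∞) (hf : IsDensityFamily μ f)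
    (w : Θ → D → ℝ≥0∞) (hw : Measurable (Function.uncurry w))
    (δB : ∀ n, (Fin n → X) → D) (hδB : IsDecisionRule δB)
    (hBayes : ∀ n (d : D), ∀ᵐ x ∂pm μ n,
      ∫⁻ θ, w θ (δB n x) * f θ n x ∂π₁ ≤ ∫⁻ θ, w θ d * f θ n x ∂π₁)
    (l : ∀ n, (Fin n → X) → ℝ≥0∞)
    (hl : ∀ n x, l n x = ∫⁻ θ, w θ (δB n x) * f θ n x ∂π₁)
    (hl1 : ∫⁻ x, l 1 x ∂pm μ 1 < ⊤)
    (c : ℝ≥0∞) (hc : 0 < c) (hc' : c ≠ ⊤)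
    (F : Set (∀ n, (Fin n → X) → ℝ≥0∞))
    (hF : ∀ ψ ∈ F, IsStoppingRule ψ)
    -- (i) every ψ ∈ 𝓕 satisfies R_N(ψ) → R(ψ)
    (hFtrunc : ∀ ψ ∈ F,
      Tendsto (fun N => RN π₂ μ c f l N ψ) atTop (nhds (R π₂ μ c f l ψ)))
    -- (ii) 𝓕 contains all truncated stopping rules
    (hFall : ∀ ψ : ∀ n, (Fin n → X) → ℝ≥0∞,
      IsStoppingRule ψ → (∃ N, TruncatedAt ψ N) → ψ ∈ F) :
    Qlim μ c (fbar π₂ f) l 0 ![] = ⨅ ψ ∈ F, R π₂ μ c f l ψ := by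
  have hfb := measurable_fbar π₂ hf
  have hcons := lintegral_fbar_snoc π₂ μ hf
  have hlm (n : ℕ) : Measurable (l n) := by
    rw [funext (hl n)]
    exact measurable_bayesLoss π₁ hf hw hδB n
  rw [Qlim_zero_eq_iInf μ c hfb hlm hl1.ne]
  refine le_antisymm (le_iInf₂ fun ψ hψ => ?_) (le_iInf fun N => ?_)
  · refine ge_of_tendsto (hFtrunc ψ hψ) ((eventually_ge_atTop 1).mono fun N hN => ?_)
    obtain ⟨N, rfl⟩ := Nat.exists_eq_add_of_le' hN
    rw [RN_eq_stageRisk]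
    exact (iInf_le _ (N + 1)).trans (Q_zero_le_stageRisk μ c hfb hlm hcons (hF ψ hψ) N.lt_succ_self)
  · have htr := truncatedAt_optimalRule μ c (fbar π₂ f) l (N + 1)
    have hmem := hFall _ (isStoppingRule_optimalRule μ c hfb hlm (N + 1)) ⟨N + 1, htr⟩
    refine (iInf₂_le _ hmem).trans ?_
    rw [R_eq_RN_of_truncatedAt π₂ μ c f l htr (hFtrunc _ hmem), RN_eq_stageRisk,
      stageRisk_optimalRule μ c hfb hlm hcons N.lt_succ_self]
    simp only [Q]
    gcongr
    exact V_succ_le μ c (fbar π₂ f) l N 1 _
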